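/- arXiv:0906.4942 — 3 statements merged into one kernel-verified Lean document; each statement's English description precedes it below -/
import Mathlib

section
/- Let g ≥ 2 be an integer and let F : ℝ^{n+2} → ℝ be an isoparametric polynomial of degree g, i.e. the evaluation of a homogeneous polynomial of degree g satisfying ‖∇F(x)‖² = g²·‖x‖^{2g−2} and ΔF(x) = c·‖x‖^{g−2} for all x, for some constant c ∈ ℝ. Then the restriction of the gradient map Φ := (1/g)·∇F to the unit sphere is surjective onto the unit sphere: for every q ∈ S^{n+1} there exists p ∈ S^{n+1} with Φ(p) = q. -/
open Real Filter Topology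

section CircleDynamics

variable {E : Type*} [NormedAddCommGroup E] [InnerProductSpace ℝ E]

/-- A point of the circle through two orthonormal vectors is a unit vector. -/
lemma norm_cos_smul_add_sin_smul {a b : E} (ha : ‖a‖ = 1) (hb : ‖b‖ = 1)
    (hab : inner ℝ a b = 0) (θ : ℝ) : ‖cos θ • a + sin θ • b‖ = 1 := by
  have h : ‖cos θ • a + sin θ • b‖ ^ 2 = 1 := by
    rw [norm_add_sq_real]
    simp only [norm_smul, inner_smul_left, inner_smul_right, hab, ha, hb, mul_pow, norm_eq_abs,
      sq_abs]
    simp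
  exact (pow_eq_one_iff_of_nonneg (norm_nonneg _) two_ne_zero).1 h

lemma analyticOnNhd_cos_smul_add_sin_smul (a b : E) {u : ℝ → ℝ}
    (hu : AnalyticOnNhd ℝ u Set.univ) :
    AnalyticOnNhd ℝ (fun θ ↦ cos (u θ) • a + sin (u θ) • b) Set.univ := fun θ _ ↦
  ((analyticAt_cos.comp (hu θ trivial)).smul analyticAt_const).add
    ((analyticAt_sin.comp (hu θ trivial)).smul analyticAt_const)

variable [CompleteSpace E]

/-- Suppose the derivative of `Φ` at each unit vector `x` maps `x` to `m Φ(x)` and `Φ(x)` to `m x`.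
Then `Φ` maps the circle through `a` and `Φ(a)` to itself, as `θ ↦ φ - m θ`. -/
lemma map_circle_of_fderiv_swap {Φ : E → E} (hΦ : AnalyticOnNhd ℝ Φ Set.univ) {m : ℝ}
    (h₁ : ∀ x, ‖x‖ = 1 → fderiv ℝ Φ x x = m • Φ x)
    (h₂ : ∀ x, ‖x‖ = 1 → fderiv ℝ Φ x (Φ x) = m • x)
    {a b : E} (ha : ‖a‖ = 1) (hb : ‖b‖ = 1) (hab : inner ℝ a b = 0) {φ : ℝ}
    (hφ : sin φ ≠ 0) (hΦa : Φ a = cos φ • a + sin φ • b) (θ : ℝ) :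
    Φ (cos θ • a + sin θ • b) = cos (φ - m * θ) • a + sin (φ - m * θ) • b := by
  set γ : ℝ → E := fun θ ↦ cos θ • a + sin θ • b with hγ
  set Y : ℝ → E := fun θ ↦ cos (φ - m * θ) • a + sin (φ - m * θ) • b with hY
  have hγ_an : AnalyticOnNhd ℝ γ Set.univ :=
    analyticOnNhd_cos_smul_add_sin_smul a b analyticOnNhd_id
  have hY_an : AnalyticOnNhd ℝ Y Set.univ :=
    analyticOnNhd_cos_smul_add_sin_smul a b
      (analyticOnNhd_const.sub (analyticOnNhd_const.mul analyticOnNhd_id))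
  have hΦγ_an : AnalyticOnNhd ℝ (fun θ ↦ Φ (γ θ)) Set.univ := fun t _ ↦
    (hΦ _ trivial).comp (hγ_an t trivial)
  have hγ_norm (t : ℝ) : ‖γ t‖ = 1 := norm_cos_smul_add_sin_smul ha hb hab t
  have hγ_deriv (t : ℝ) : HasDerivAt γ (-sin t • a + cos t • b) t :=
    ((hasDerivAt_cos t).smul_const a).add ((hasDerivAt_sin t).smul_const b)
  have hY_deriv (t : ℝ) :
      HasDerivAt Y ((m * sin (φ - m * t)) • a + (-(m * cos (φ - m * t))) • b) t := by
    have hu : HasDerivAt (fun t ↦ φ - m * t) (-m) t := by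
      simpa using ((hasDerivAt_id t).const_mul m).const_sub φ
    have := (hu.cos.smul_const a).add (hu.sin.smul_const b)
    exact this.congr_deriv (by module)
  have hΦγ_deriv (t : ℝ) :
      HasDerivAt (fun t ↦ Φ (γ t)) (fderiv ℝ Φ (γ t) (-sin t • a + cos t • b)) t :=
    ((hΦ _ trivial).differentiableAt.hasFDerivAt).comp_hasDerivAt t (hγ_deriv t)
  set α : ℝ → ℝ := fun t ↦ φ - m * t - t with hα
  set A : ℝ → E →L[ℝ] E := fun t ↦
    (sin (α t))⁻¹ • (-fderiv ℝ Φ (γ t) - (m * cos (α t)) • ContinuousLinearMap.id ℝ E) with hA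
  have hα_cont : Continuous α := by fun_prop
  have hA_cont : ContinuousAt A 0 := by
    have hγc : ContinuousAt γ 0 := (hγ_an 0 trivial).continuousAt
    have hdc : ContinuousAt (fun t ↦ fderiv ℝ Φ (γ t)) 0 :=
      ContinuousAt.comp (f := γ) (hΦ.fderiv (γ 0) trivial).continuousAt hγc
    have hs : ContinuousAt (fun t ↦ (sin (α t))⁻¹) 0 :=
      (continuous_sin.comp hα_cont).continuousAt.inv₀ (by simpa [hα] using hφ)
    have hc : ContinuousAt (fun t ↦ m * cos (α t)) 0 := by fun_prop
    exact hs.smul (hdc.neg.sub (hc.smul continuousAt_const))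
  have hD_deriv (t : ℝ) (ht : sin (α t) ≠ 0) :
      HasDerivAt (fun t ↦ Φ (γ t) - Y t) (A t (Φ (γ t) - Y t)) t := by
    have hd := (hΦγ_deriv t).sub (hY_deriv t)
    refine hd.congr_deriv (Eq.symm ?_)
    have e₁ : sin (α t) • (-sin t • a + cos t • b) = Y t - cos (α t) • γ t := by
      have hc : cos (φ - m * t) = cos (α t) * cos t - sin (α t) * sin t := by
        rw [← cos_add]; simp [hα]
      have hs : sin (φ - m * t) = sin (α t) * cos t + cos (α t) * sin t := by
        rw [← sin_add]; simp [hα]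
      simp only [hY, hγ, hc, hs]
      module
    have e₂ : sin (α t) • ((m * sin (φ - m * t)) • a + (-(m * cos (φ - m * t))) • b)
        = m • (γ t - cos (α t) • Y t) := by
      have hc : cos t = cos (φ - m * t) * cos (α t) + sin (φ - m * t) * sin (α t) := by
        rw [← cos_sub]; simp [hα]
      have hs : sin t = sin (φ - m * t) * cos (α t) - cos (φ - m * t) * sin (α t) := by
        rw [← sin_sub]; simp [hα]
      simp only [hY, hγ, hc, hs]
      module
    have e₃ := congrArg (fderiv ℝ Φ (γ t)) e₁
    rw [map_smul, map_sub, map_smul, h₁ _ (hγ_norm t)] at e₃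
    refine (smul_right_injective E ht) ?_
    simp only [smul_sub]
    rw [e₂, e₃]
    simp only [hA, smul_apply, smul_inv_smul₀ ht]
    simp only [sub_apply, neg_apply, smul_apply, ContinuousLinearMap.id_apply, map_sub,
      h₂ _ (hγ_norm t)]
    module
  have hev : (fun t ↦ Φ (γ t) - Y t) =ᶠ[𝓝 0] fun _ ↦ 0 := by
    refine ODE_solution_unique_of_eventually (v := fun t x ↦ A t x) (s := fun _ ↦ Set.univ)
      (K := ‖A 0‖₊ + 1) ?_ ?_ ?_ ?_
    · have : ∀ᶠ t in 𝓝 (0 : ℝ), ‖A t‖₊ < ‖A 0‖₊ + 1 :=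
        hA_cont.nnnorm.eventually (gt_mem_nhds (lt_add_one _))
      filter_upwards [this] with t ht
      exact ((A t).lipschitz.weaken ht.le).lipschitzOnWith
    · have : ∀ᶠ t in 𝓝 (0 : ℝ), sin (α t) ≠ 0 :=
        (continuous_sin.comp hα_cont).continuousAt.eventually_ne (by simpa [hα] using hφ)
      filter_upwards [this] with t ht using ⟨hD_deriv t ht, trivial⟩
    · exact .of_forall fun t ↦ ⟨by simpa using hasDerivAt_const t (0 : E), trivial⟩
    · simp [hγ, hY, hΦa]
  have := AnalyticOnNhd.eq_of_eventuallyEq (hΦγ_an.sub hY_an) analyticOnNhd_const hev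
  exact sub_eq_zero.1 (congrFun this θ)

/-- Surjectivity onto the sphere at points `q` linearly independent of `Φ(q)`. -/
lemma exists_unit_map_eq_of_inner_sq_ne_one {Φ : E → E} (hΦ : AnalyticOnNhd ℝ Φ Set.univ)
    {m : ℝ} (hm : m ≠ 0) (h₁ : ∀ x, ‖x‖ = 1 → fderiv ℝ Φ x x = m • Φ x)
    (h₂ : ∀ x, ‖x‖ = 1 → fderiv ℝ Φ x (Φ x) = m • x)
    (hnorm : ∀ x, ‖x‖ = 1 → ‖Φ x‖ = 1) {q : E} (hq : ‖q‖ = 1)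
    (hne : inner ℝ (Φ q) q ^ 2 ≠ 1) : ∃ p, ‖p‖ = 1 ∧ Φ p = q := by
  set k : ℝ := inner ℝ (Φ q) q with hk
  have hk_abs : |k| ≤ 1 := by
    simpa [hq, hnorm q hq] using abs_real_inner_le_norm (Φ q) q
  have hk_sq : k ^ 2 < 1 := lt_of_le_of_ne ((sq_le_one_iff_abs_le_one k).2 hk_abs) hne
  have hcos : cos (arccos k) = k := cos_arccos (abs_le.1 hk_abs).1 (abs_le.1 hk_abs).2
  have hsin_sq : sin (arccos k) ^ 2 = 1 - k ^ 2 := by rw [sin_sq, hcos]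
  have hsin : sin (arccos k) ≠ 0 := fun h ↦ by rw [h] at hsin_sq; linarith
  have hqq : inner ℝ q q = (1 : ℝ) := by rw [real_inner_self_eq_norm_sq, hq, one_pow]
  set b : E := (sin (arccos k))⁻¹ • (Φ q - k • q) with hb
  have hab : inner ℝ q b = 0 := by
    rw [hb, inner_smul_right, inner_sub_right, inner_smul_right, hqq, real_inner_comm, ← hk]
    ring
  have hb_norm : ‖b‖ = 1 := by
    have h : ‖b‖ ^ 2 = 1 := by
      rw [hb, norm_smul, mul_pow, norm_sub_sq_real, norm_smul, inner_smul_right, ← hk, hq,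
        hnorm q hq, norm_eq_abs, norm_eq_abs, sq_abs, mul_pow, sq_abs, inv_pow, hsin_sq]
      have : 1 - k ^ 2 ≠ 0 := by linarith
      field_simp
      ring
    exact (pow_eq_one_iff_of_nonneg (norm_nonneg _) two_ne_zero).1 h
  have hΦq : Φ q = cos (arccos k) • q + sin (arccos k) • b := by
    rw [hb, smul_inv_smul₀ hsin, hcos]; abel
  refine ⟨_, norm_cos_smul_add_sin_smul hq hb_norm hab (arccos k / m), ?_⟩
  rw [map_circle_of_fderiv_swap hΦ h₁ h₂ hq hb_norm hab hsin hΦq, mul_div_cancel₀ _ hm]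
  simp

lemma exists_unit_map_eq_of_fderiv_swap [FiniteDimensional ℝ E] {Φ : E → E}
    (hΦ : AnalyticOnNhd ℝ Φ Set.univ)
    {m : ℝ} (hm : m ≠ 0) (h₁ : ∀ x, ‖x‖ = 1 → fderiv ℝ Φ x x = m • Φ x)
    (h₂ : ∀ x, ‖x‖ = 1 → fderiv ℝ Φ x (Φ x) = m • x)
    (hnorm : ∀ x, ‖x‖ = 1 → ‖Φ x‖ = 1) {q v : E} (hq : ‖q‖ = 1) (hv : ‖v‖ = 1)
    (hqv : inner ℝ q v = 0) : ∃ p, ‖p‖ = 1 ∧ Φ p = q := by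
  have hclosed : IsClosed (Φ '' Metric.sphere 0 1) :=
    ((isCompact_sphere 0 1).image_of_continuousOn
      (hΦ.continuousOn.mono (Set.subset_univ _))).isClosed
  set γ : ℝ → E := fun θ ↦ cos θ • q + sin θ • v with hγ
  have hγ_an : AnalyticOnNhd ℝ γ Set.univ :=
    analyticOnNhd_cos_smul_add_sin_smul q v analyticOnNhd_id
  have hγ_norm (t : ℝ) : ‖γ t‖ = 1 := norm_cos_smul_add_sin_smul hq hv hqv t
  have hγ_zero : γ 0 = q := by simp [hγ]
  have hγ_pi : γ π = -q := by simp [hγ]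
  set f : ℝ → ℝ := fun t ↦ inner ℝ (Φ (γ t)) (γ t) with hf
  have hf_an : AnalyticOnNhd ℝ f Set.univ := fun t _ ↦
    ((innerSL ℝ (E := E)).analyticAt_bilinear _).comp₂
      ((hΦ _ trivial).comp (hγ_an t trivial)) (hγ_an t trivial)
  by_cases hev : ∀ᶠ t in 𝓝 (0 : ℝ), f t ^ 2 = 1
  · have hsq : (fun t ↦ f t ^ 2) = fun _ ↦ 1 :=
      AnalyticOnNhd.eq_of_eventuallyEq (hf_an.pow 2) analyticOnNhd_const hev
    have hcst : Set.EqOn f 1 Set.univ ∨ Set.EqOn f (-1) Set.univ :=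
      isPreconnected_univ.eq_one_or_eq_neg_one_of_sq_eq hf_an.continuousOn
        fun t _ ↦ congrFun hsq t
    rcases hcst with h | h
    · refine ⟨q, hq, ?_⟩
      have h0 : inner ℝ (Φ q) q = (1 : ℝ) := by simpa [hf, hγ_zero] using h (Set.mem_univ 0)
      exact (inner_eq_one_iff_of_norm_eq_one (𝕜 := ℝ) (hnorm q hq) hq).1 h0
    · refine ⟨-q, by simpa using hq, ?_⟩
      have h0 : inner ℝ (Φ (-q)) q = (1 : ℝ) := by
        simpa [hf, hγ_pi, inner_neg_right] using h (Set.mem_univ π)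
      exact (inner_eq_one_iff_of_norm_eq_one (𝕜 := ℝ)
        (hnorm (-q) (by simpa using hq)) hq).1 h0
  · have hfr : ∃ᶠ t in 𝓝 (0 : ℝ), γ t ∈ Φ '' Metric.sphere 0 1 := by
      refine (not_eventually.1 hev).mono fun t ht ↦ ?_
      obtain ⟨p, hp, hpq⟩ :=
        exists_unit_map_eq_of_inner_sq_ne_one hΦ hm h₁ h₂ hnorm (hγ_norm t) ht
      exact ⟨p, by simpa using hp, hpq⟩
    have hlim : Tendsto γ (𝓝 0) (𝓝 q) := hγ_zero ▸ (hγ_an 0 trivial).continuousAt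
    obtain ⟨p, hp, hpq⟩ := hclosed.mem_of_frequently_of_tendsto hfr hlim
    exact ⟨p, by simpa using hp, hpq⟩

end CircleDynamics

section Gradient

open InnerProductSpace

variable {E : Type*} [NormedAddCommGroup E] [InnerProductSpace ℝ E] [CompleteSpace E]

lemma AnalyticOnNhd.gradient {F : E → ℝ} (hF : AnalyticOnNhd ℝ F Set.univ) :
    AnalyticOnNhd ℝ (gradient F) Set.univ := fun x _ ↦
  ((toDual ℝ E).symm.toContinuousLinearEquiv.toContinuousLinearMap.analyticAt _).comp
    (hF.fderiv x trivial)

lemma inner_gradient_eq_fderiv (F : E → ℝ) (x v : E) :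
    inner ℝ (gradient F x) v = fderiv ℝ F x v := by
  rw [← toDual_gradient, toDual_apply_apply]

/-- The derivative of a gradient is self-adjoint. -/
lemma inner_fderiv_gradient_comm {F : E → ℝ} (hF : AnalyticOnNhd ℝ F Set.univ) (x v w : E) :
    inner ℝ (fderiv ℝ (gradient F) x v) w = inner ℝ v (fderiv ℝ (gradient F) x w) := by
  have key (v w : E) : inner ℝ (fderiv ℝ (gradient F) x v) w = fderiv ℝ (fderiv ℝ F) x v w := by
    have hd := (hF.fderiv x trivial).differentiableAt.hasFDerivAt
    have h := ((toDual ℝ E).symm.toContinuousLinearEquiv.toContinuousLinearMap.hasFDerivAt).comp x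
      hd
    have h' : fderiv ℝ (gradient F) x = _ := h.fderiv
    rw [h']
    exact toDual_symm_apply
  have hsymm := (hF x trivial).contDiffAt (n := ⊤) |>.isSymmSndFDerivAt (by simp)
  rw [key, real_inner_comm, key, hsymm.eq]

/-- The gradient of a homogeneous function of degree `m + 1` is homogeneous of degree `m`. -/
lemma gradient_smul_of_homogeneous {F : E → ℝ} (hF : AnalyticOnNhd ℝ F Set.univ) {m : ℕ}
    (hom : ∀ (t : ℝ) x, F (t • x) = t ^ (m + 1) * F x) {t : ℝ} (ht : t ≠ 0) (x : E) :
    gradient F (t • x) = t ^ m • gradient F x := by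
  refine ext_inner_right ℝ fun v ↦ ?_
  rw [inner_smul_left, inner_gradient_eq_fderiv, inner_gradient_eq_fderiv]
  have h1 : HasFDerivAt (fun y : E ↦ F (t • y))
      ((fderiv ℝ F (t • x)).comp (t • ContinuousLinearMap.id ℝ E)) x :=
    (hF (t • x) trivial).differentiableAt.hasFDerivAt.comp x ((hasFDerivAt_id x).const_smul t)
  have h2 : HasFDerivAt (fun y : E ↦ F (t • y)) (t ^ (m + 1) • fderiv ℝ F x) x := by
    simp_rw [hom]
    exact (hF x trivial).differentiableAt.hasFDerivAt.const_mul _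
  have h := congrArg (fun L : E →L[ℝ] ℝ ↦ L v) (h1.unique h2)
  simp only [ContinuousLinearMap.comp_apply, smul_apply,
    ContinuousLinearMap.id_apply, map_smul, smul_eq_mul] at h
  refine mul_left_cancel₀ ht ?_
  rw [h]
  simp
  ring

lemma fderiv_gradient_self_of_homogeneous {F : E → ℝ} (hF : AnalyticOnNhd ℝ F Set.univ) {m : ℕ}
    (hom : ∀ (t : ℝ) x, F (t • x) = t ^ (m + 1) * F x) (x : E) :
    fderiv ℝ (gradient F) x x = (m : ℝ) • gradient F x := by
  have h1 : HasDerivAt (fun t : ℝ ↦ gradient F (t • x)) (fderiv ℝ (gradient F) x x) 1 := by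
    have hx : HasDerivAt (fun t : ℝ ↦ t • x) x 1 := by
      simpa using (hasDerivAt_id (1 : ℝ)).smul_const x
    have hg : HasFDerivAt (gradient F) (fderiv ℝ (gradient F) x) ((1 : ℝ) • x) := by
      rw [one_smul]
      exact (hF.gradient x trivial).differentiableAt.hasFDerivAt
    exact hg.comp_hasDerivAt 1 hx
  have h2 : HasDerivAt (fun t : ℝ ↦ t ^ m • gradient F x) ((m : ℝ) • gradient F x) 1 := by
    simpa using (hasDerivAt_pow m (1 : ℝ)).smul_const (gradient F x)
  refine h1.unique (h2.congr_of_eventuallyEq ?_)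
  filter_upwards [eventually_ne_nhds one_ne_zero] with t ht
  exact gradient_smul_of_homogeneous hF hom ht x

/-- Differentiating the eikonal equation `‖∇F‖² = k ‖x‖^{2m}`. -/
lemma fderiv_gradient_gradient_of_eikonal {F : E → ℝ} (hF : AnalyticOnNhd ℝ F Set.univ) {m : ℕ}
    {k : ℝ} (heik : ∀ x, ‖gradient F x‖ ^ 2 = k * ‖x‖ ^ (2 * m)) {x : E} (hx : ‖x‖ = 1) :
    fderiv ℝ (gradient F) x (gradient F x) = (k * m) • x := by
  refine ext_inner_right ℝ fun v ↦ ?_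
  have h1 := (hF.gradient x trivial).differentiableAt.hasFDerivAt.norm_sq
  have h2 := ((hasFDerivAt_id (𝕜 := ℝ) x).norm_sq.pow m).const_mul k
  have h := congrArg (fun L : E →L[ℝ] ℝ ↦ L v) (h1.unique
    (h2.congr_of_eventuallyEq (.of_forall fun y ↦ by simp [heik, pow_mul])))
  rw [inner_fderiv_gradient_comm hF, inner_smul_left]
  simp [hx] at h
  simp
  linarith

end Gradient

lemma MvPolynomial.IsHomogeneous.eval_smul_eq {σ R : Type*} [CommSemiring R]
    {P : MvPolynomial σ R} {d : ℕ} (hP : P.IsHomogeneous d) (t : R) (x : σ → R) :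
    MvPolynomial.eval (t • x) P = t ^ d * MvPolynomial.eval x P := by
  rw [MvPolynomial.eval_eq, MvPolynomial.eval_eq, Finset.mul_sum]
  refine Finset.sum_congr rfl fun s hs ↦ ?_
  have hdeg : ∑ i ∈ s.support, s i = d := by
    rw [← hP (MvPolynomial.mem_support_iff.1 hs), Finsupp.weight_apply, Finsupp.sum]
    simp
  simp only [Pi.smul_apply, smul_eq_mul, mul_pow, Finset.prod_mul_distrib,
    Finset.prod_pow_eq_pow_sum, hdeg]
  ring


/-- The Euclidean Laplacian of a function on a finite-dimensional real inner product space,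
computed as the sum of second derivatives along an orthonormal basis. -/
noncomputable def laplacian {E : Type*} [NormedAddCommGroup E] [InnerProductSpace ℝ E]
    [FiniteDimensional ℝ E] (f : E → ℝ) (x : E) : ℝ :=
  ∑ i, iteratedFDeriv ℝ 2 f x ![stdOrthonormalBasis ℝ E i, stdOrthonormalBasis ℝ E i]

/-- Let `F` be an isoparametric polynomial of degree `g ≥ 2` (a homogeneous
polynomial of degree `g` satisfying `‖∇F(x)‖² = g² ‖x‖^{2g-2}` and `ΔF(x) = c ‖x‖^{g-2}`).
Then the restriction of the gradient map `Φ = (1/g) ∇F` to the unit sphere is surjective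
onto the unit sphere. -/
theorem gradientMap_surjective_on_sphere (n g : ℕ) (hg : 2 ≤ g)
    (F : EuclideanSpace ℝ (Fin (n + 2)) → ℝ)
    (P : MvPolynomial (Fin (n + 2)) ℝ) (hP : P.IsHomogeneous g)
    (hFP : ∀ x, F x = MvPolynomial.eval x P)
    (hCM1 : ∀ x, ‖gradient F x‖ ^ 2 = (g : ℝ) ^ 2 * ‖x‖ ^ (2 * g - 2))
    (c : ℝ) (hCM2 : ∀ x, laplacian F x = c * ‖x‖ ^ (g - 2))
    (Φ : EuclideanSpace ℝ (Fin (n + 2)) → EuclideanSpace ℝ (Fin (n + 2)))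
    (hΦ : ∀ x, Φ x = (g : ℝ)⁻¹ • gradient F x) :
    ∀ q : EuclideanSpace ℝ (Fin (n + 2)), ‖q‖ = 1 →
      ∃ p : EuclideanSpace ℝ (Fin (n + 2)), ‖p‖ = 1 ∧ Φ p = q := by

  intro q hq
  obtain ⟨m, rfl⟩ : ∃ m, g = m + 1 := ⟨g - 1, by omega⟩
  have hF : AnalyticOnNhd ℝ F Set.univ := by
    rw [funext hFP]
    exact AnalyticOnNhd.eval_continuousLinearMap
      (EuclideanSpace.equiv (Fin (n + 2)) ℝ).toContinuousLinearMap P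
  have hom (t : ℝ) (x) : F (t • x) = t ^ (m + 1) * F x := by
    rw [hFP, hFP]
    exact hP.eval_smul_eq t x
  have heik (x) : ‖gradient F x‖ ^ 2 = ((m + 1 : ℕ) : ℝ) ^ 2 * ‖x‖ ^ (2 * m) := hCM1 x
  have hg0 : ((m + 1 : ℕ) : ℝ) ≠ 0 := by positivity
  have hm0 : (m : ℝ) ≠ 0 := by
    have : m ≠ 0 := by omega
    exact_mod_cast this
  obtain rfl : Φ = fun x ↦ ((m + 1 : ℕ) : ℝ)⁻¹ • gradient F x := funext hΦ
  have hfd (x) : fderiv ℝ (fun x ↦ ((m + 1 : ℕ) : ℝ)⁻¹ • gradient F x) x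
      = ((m + 1 : ℕ) : ℝ)⁻¹ • fderiv ℝ (gradient F) x :=
    ((hF.gradient x trivial).differentiableAt.hasFDerivAt.const_smul (((m + 1 : ℕ) : ℝ)⁻¹)).fderiv
  obtain ⟨v, hv, hqv⟩ : ∃ v : EuclideanSpace ℝ (Fin (n + 2)), ‖v‖ = 1 ∧ inner ℝ q v = 0 := by
    have hpos : 0 < Module.finrank ℝ (ℝ ∙ q)ᗮ := by
      have h := Submodule.finrank_add_finrank_orthogonal (ℝ ∙ q)
      rw [finrank_euclideanSpace_fin] at h
      have := finrank_span_singleton (K := ℝ) (v := q) (norm_ne_zero_iff.1 (by simp [hq]))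
      omega
    have := Module.finrank_pos_iff.1 hpos
    obtain ⟨w, hw⟩ := exists_norm_eq (ℝ ∙ q)ᗮ (zero_le_one (α := ℝ))
    exact ⟨w, hw, Submodule.mem_orthogonal_singleton_iff_inner_right.1 w.2⟩
  refine exists_unit_map_eq_of_fderiv_swap (m := m)
    (Φ := fun x ↦ ((m + 1 : ℕ) : ℝ)⁻¹ • gradient F x)
    (fun x _ ↦ (hF.gradient x trivial).const_smul (c := ((m + 1 : ℕ) : ℝ)⁻¹)) hm0 ?_ ?_ ?_ hq hv hqv
  · intro x _
    rw [hfd, smul_apply, fderiv_gradient_self_of_homogeneous hF hom,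
      smul_comm]
  · intro x hx
    rw [hfd, smul_apply, map_smul,
      fderiv_gradient_gradient_of_eikonal hF heik hx, smul_smul, smul_smul]
    congr 1
    field_simp
  · intro x hx
    have h := heik x
    rw [hx, one_pow, mul_one] at h
    have h' : ‖gradient F x‖ = ((m + 1 : ℕ) : ℝ) :=
      (sq_eq_sq₀ (norm_nonneg _) (by positivity)).1 h
    rw [norm_smul, h', norm_inv, Real.norm_natCast, inv_mul_cancel₀ hg0]
end

section
/- Let g ≥ 1 be an integer and let F : ℝ^{n+2} → ℝ be the evaluation of a homogeneous polynomial of degree g satisfying ‖∇F(x)‖² = g²·‖x‖^{2g−2} for all x. If ‖p‖ = 1 and F(p) = 1, then Φ(p) = p, where Φ := (1/g)·∇F. In particular, the focal submanifold M_1 = { p ∈ S^{n+1} : F(p) = 1 } is contained in the fixed point set of Φ. -/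
open scoped InnerProductSpace in
/-- Euler's identity `⟪∇F(x), x⟫ = g F(x)` for functions that are homogeneous of degree `g`
along the line through `x`. -/
theorem inner_gradient_self_of_homogeneous {E : Type*} [NormedAddCommGroup E]
    [InnerProductSpace ℝ E] [CompleteSpace E] {F : E → ℝ} {g : ℕ} {x : E}
    (hF : DifferentiableAt ℝ F x) (hom : ∀ t : ℝ, F (t • x) = t ^ g * F x) :
    ⟪gradient F x, x⟫_ℝ = g * F x := by
  have hline : HasDerivAt (fun t : ℝ => t • x) x 1 := by
    simpa using (hasDerivAt_id (1 : ℝ)).smul_const x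
  have hgrad : HasFDerivAt F (InnerProductSpace.toDual ℝ E (gradient F x)) ((1 : ℝ) • x) := by
    simpa using hF.hasGradientAt.hasFDerivAt
  have hcomp := hgrad.comp_hasDerivAt (1 : ℝ) hline
  have hpow : HasDerivAt (F ∘ fun t : ℝ => t • x) (g * F x) 1 := by
    have h := (hasDerivAt_pow g (1 : ℝ)).mul_const (F x)
    rw [one_pow, mul_one] at h
    exact h.congr_of_eventuallyEq (.of_forall hom)
  simpa using hcomp.unique hpow

theorem MvPolynomial.IsHomogeneous.eval_const_mul {σ R : Type*} [CommSemiring R]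
    {P : MvPolynomial σ R} {g : ℕ} (hP : P.IsHomogeneous g) (t : R) (x : σ → R) :
    MvPolynomial.eval (fun i => t * x i) P = t ^ g * MvPolynomial.eval x P := by
  rw [eval_eq, eval_eq, Finset.mul_sum]
  refine Finset.sum_congr rfl fun d hd => ?_
  have hdeg : ∑ i ∈ d.support, d i = g := by
    rw [← hP (mem_support_iff.mp hd), Finsupp.weight_apply, Finsupp.sum]
    simp
  simp only [mul_pow, Finset.prod_mul_distrib, Finset.prod_pow_eq_pow_sum, hdeg]
  ring

/-- For `F` the evaluation of a homogeneous polynomial of degree `g ≥ 1`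
satisfying `‖∇F(x)‖² = g² ‖x‖^{2g-2}`: if `‖p‖ = 1` and `F(p) = 1` then `Φ(p) = p` for the
gradient map `Φ = (1/g) ∇F`; i.e. the focal submanifold `M₁ = {p ∈ S^{n+1} : F(p) = 1}`
is contained in the fixed point set of `Φ`. -/
theorem gradientMap_fixes_focal_M1 (n g : ℕ) (hg : 1 ≤ g)
    (F : EuclideanSpace ℝ (Fin (n + 2)) → ℝ)
    (P : MvPolynomial (Fin (n + 2)) ℝ) (hP : P.IsHomogeneous g)
    (hFP : ∀ x, F x = MvPolynomial.eval x P)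
    (hCM1 : ∀ x, ‖gradient F x‖ ^ 2 = (g : ℝ) ^ 2 * ‖x‖ ^ (2 * g - 2))
    (Φ : EuclideanSpace ℝ (Fin (n + 2)) → EuclideanSpace ℝ (Fin (n + 2)))
    (hΦ : ∀ x, Φ x = (g : ℝ)⁻¹ • gradient F x) :
    ∀ p : EuclideanSpace ℝ (Fin (n + 2)), ‖p‖ = 1 → F p = 1 → Φ p = p := by
  intro p hp hFp
  have hg0 : (g : ℝ) ≠ 0 := by exact_mod_cast (by omega : g ≠ 0)
  have hsq : ‖gradient F p‖ ^ 2 = (g : ℝ) ^ 2 := by simpa [hp] using hCM1 p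
  have hdiff : DifferentiableAt ℝ F p := by
    by_contra h
    rw [gradient_eq_zero_of_not_differentiableAt h] at hsq
    exact pow_ne_zero 2 hg0 (by simpa using hsq.symm)
  have hom (t : ℝ) : F (t • p) = t ^ g * F p := by
    rw [hFP, hFP, ← hP.eval_const_mul]
    rfl
  have heuler := inner_gradient_self_of_homogeneous hdiff hom
  rw [hFp, mul_one] at heuler
  have hgrad : gradient F p = (g : ℝ) • p := by
    have h : ‖gradient F p - (g : ℝ) • p‖ ^ 2 = 0 := by
      rw [norm_sub_sq_real, inner_smul_right, heuler, hsq, norm_smul, hp, mul_one,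
        Real.norm_eq_abs, sq_abs]
      ring
    rwa [sq_eq_zero_iff, norm_eq_zero, sub_eq_zero] at h
  rw [hΦ, hgrad, inv_smul_smul₀ hg0]
end

section
/- Let N ≥ 3 and k ≥ 1 be integers. Let G : ℝ^N → ℝ^N be a map each of whose N components is a harmonic homogeneous polynomial of degree k, and suppose ‖G(x)‖ = ‖x‖^k for all x ∈ ℝ^N (so G maps S^{N−1} into S^{N−1}). Let h : (0, ∞) → ℝ be a C² function satisfying the ODE −h''(r) − (N−1)·h'(r)/r + k(k+N−2)·h(r)/r² = h(r)·(1 − h(r)²) for all r > 0. Define u : ℝ^N \ {0} → ℝ^N by u(x) = h(‖x‖)·‖x‖^{−k}·G(x) (i.e. u(x) = G(x/‖x‖)·h(‖x‖)). Then u solves the Ginzburg–Landau system Δu = u·(‖u‖² − 1) on ℝ^N \ {0}, where Δ acts componentwise; moreover ‖u(x)‖ = |h(‖x‖)| for all x ≠ 0. -/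
section Calculus

variable {E : Type*} [NormedAddCommGroup E]

theorem ContDiffAt.differentiableAt_fderiv_apply [NormedSpace ℝ E] {f : E → ℝ} {x : E}
    (hf : ContDiffAt ℝ 2 f x) (e : E) : DifferentiableAt ℝ (fun y => fderiv ℝ f y e) x :=
  ((hf.fderiv_right (m := 1) (by norm_num)).differentiableAt (by norm_num)).clm_apply
    (differentiableAt_const e)

theorem ContDiffAt.differentiableAt_deriv {φ : ℝ → ℝ} {r : ℝ} (hφ : ContDiffAt ℝ 2 φ r) :
    DifferentiableAt ℝ (deriv φ) r := by
  simpa using hφ.differentiableAt_fderiv_apply 1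

theorem ContDiffAt.eventually_differentiableAt [NormedSpace ℝ E] {f : E → ℝ} {x : E}
    (hf : ContDiffAt ℝ 2 f x) : ∀ᶠ y in nhds x, DifferentiableAt ℝ f y := by
  filter_upwards [hf.eventually (by simp)] with y hy
  exact hy.differentiableAt (by norm_num)

theorem iteratedFDeriv_two_eq_fderiv_fderiv_apply [NormedSpace ℝ E] {f : E → ℝ} {x : E}
    (hf : ContDiffAt ℝ 2 f x) (e : E) :
    iteratedFDeriv ℝ 2 f x ![e, e] = fderiv ℝ (fun y => fderiv ℝ f y e) x e := by
  have hd : DifferentiableAt ℝ (fderiv ℝ f) x :=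
    (hf.fderiv_right (m := 1) (by norm_num)).differentiableAt (by norm_num)
  rw [iteratedFDeriv_two_apply, fderiv_clm_apply hd (differentiableAt_const e)]
  simp

theorem iteratedFDeriv_two_mul_apply [NormedSpace ℝ E] {f g : E → ℝ} {x : E}
    (hf : ContDiffAt ℝ 2 f x) (hg : ContDiffAt ℝ 2 g x) (e : E) :
    iteratedFDeriv ℝ 2 (fun y => f y * g y) x ![e, e] =
      iteratedFDeriv ℝ 2 f x ![e, e] * g x + 2 * (fderiv ℝ f x e * fderiv ℝ g x e) +
        f x * iteratedFDeriv ℝ 2 g x ![e, e] := by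
  rw [iteratedFDeriv_two_eq_fderiv_fderiv_apply (hf.mul hg),
    iteratedFDeriv_two_eq_fderiv_fderiv_apply hf, iteratedFDeriv_two_eq_fderiv_fderiv_apply hg]
  have heq : (fun y => fderiv ℝ (fun y => f y * g y) y e) =ᶠ[nhds x]
      fun y => f y * fderiv ℝ g y e + g y * fderiv ℝ f y e := by
    filter_upwards [hf.eventually_differentiableAt, hg.eventually_differentiableAt] with y hfy hgy
    rw [fderiv_fun_mul hfy hgy]
    simp
  have hf' := hf.eventually_differentiableAt.self_of_nhds
  have hg' := hg.eventually_differentiableAt.self_of_nhds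
  rw [heq.fderiv_eq, ((hf'.hasFDerivAt.fun_mul
    (hg.differentiableAt_fderiv_apply e).hasFDerivAt).fun_add
    (hg'.hasFDerivAt.fun_mul (hf.differentiableAt_fderiv_apply e).hasFDerivAt)).fderiv]
  simp only [add_apply, smul_apply, smul_eq_mul]
  ring

variable [InnerProductSpace ℝ E]

theorem hasFDerivAt_norm_of_ne_zero {x : E} (hx : x ≠ 0) :
    HasFDerivAt (fun y : E => ‖y‖) (‖x‖⁻¹ • innerSL ℝ x) x := by
  have hs := (hasStrictFDerivAt_norm_sq x).hasFDerivAt.sqrt (by simpa using hx)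
  simp only [Real.sqrt_sq (norm_nonneg _)] at hs
  convert! hs using 1
  rw [← Nat.cast_smul_eq_nsmul ℝ, smul_smul]
  congr 1
  field_simp
  norm_num

theorem fderiv_comp_norm_apply {φ : ℝ → ℝ} {x : E} (hx : x ≠ 0)
    (hφ : DifferentiableAt ℝ φ ‖x‖) (e : E) :
    fderiv ℝ (fun y => φ ‖y‖) x e = deriv φ ‖x‖ * (‖x‖⁻¹ * inner ℝ x e) := by
  have hc : HasFDerivAt (fun y : E => φ ‖y‖) _ x :=
    hφ.hasDerivAt.comp_hasFDerivAt x (hasFDerivAt_norm_of_ne_zero hx)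
  rw [hc.fderiv]
  simp

theorem ContDiffAt.comp_norm {φ : ℝ → ℝ} {x : E} (hx : x ≠ 0) (hφ : ContDiffAt ℝ 2 φ ‖x‖) :
    ContDiffAt ℝ 2 (fun y => φ ‖y‖) x :=
  ContDiffAt.comp x hφ (contDiffAt_norm ℝ hx)

theorem iteratedFDeriv_two_comp_norm_apply {φ : ℝ → ℝ} {x : E} (hx : x ≠ 0)
    (hφ : ContDiffAt ℝ 2 φ ‖x‖) (e : E) :
    iteratedFDeriv ℝ 2 (fun y => φ ‖y‖) x ![e, e] =
      deriv (deriv φ) ‖x‖ * (inner ℝ x e ^ 2 / ‖x‖ ^ 2) +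
        deriv φ ‖x‖ * (‖e‖ ^ 2 / ‖x‖ - inner ℝ x e ^ 2 / ‖x‖ ^ 3) := by
  have hx' : ‖x‖ ≠ 0 := norm_ne_zero_iff.2 hx
  have hn := hasFDerivAt_norm_of_ne_zero hx
  rw [iteratedFDeriv_two_eq_fderiv_fderiv_apply (hφ.comp_norm hx)]
  have heq : (fun y => fderiv ℝ (fun y => φ ‖y‖) y e) =ᶠ[nhds x]
      fun y => deriv φ ‖y‖ * (‖y‖⁻¹ * inner ℝ y e) := by
    filter_upwards [hn.continuousAt.eventually hφ.eventually_differentiableAt,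
      isOpen_ne.mem_nhds hx] with y hy hy0
    exact fderiv_comp_norm_apply hy0 hy e
  have hd : HasFDerivAt (fun y : E => deriv φ ‖y‖) _ x :=
    hφ.differentiableAt_deriv.hasDerivAt.comp_hasFDerivAt x hn
  have hinv : HasFDerivAt (fun y : E => ‖y‖⁻¹) _ x :=
    (hasDerivAt_inv hx').comp_hasFDerivAt x hn
  have hin : HasFDerivAt (fun y : E => inner ℝ y e) (innerSL ℝ e) x := by
    simpa [real_inner_comm] using (innerSL ℝ e).hasFDerivAt (x := x)
  rw [heq.fderiv_eq, (hd.fun_mul (hinv.fun_mul hin)).fderiv]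
  simp only [add_apply, smul_apply, smul_eq_mul, innerSL_apply_apply, real_inner_self_eq_norm_sq]
  field_simp
  ring

variable [FiniteDimensional ℝ E]

theorem laplacian_congr {f g : E → ℝ} {x : E} (hfg : f =ᶠ[nhds x] g) :
    laplacian f x = laplacian g x := by
  simp only [laplacian, hfg.iteratedFDeriv ℝ 2 |>.eq_of_nhds]

theorem laplacian_radial_mul {φ : ℝ → ℝ} {g : E → ℝ} {x : E} (hx : x ≠ 0)
    (hφ : ContDiffAt ℝ 2 φ ‖x‖) (hg : ContDiffAt ℝ 2 g x) :
    laplacian (fun y => φ ‖y‖ * g y) x =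
      (deriv (deriv φ) ‖x‖ + (Module.finrank ℝ E - 1) * deriv φ ‖x‖ / ‖x‖) * g x +
        2 * (deriv φ ‖x‖ / ‖x‖ * fderiv ℝ g x x) + φ ‖x‖ * laplacian g x := by
  set b := stdOrthonormalBasis ℝ E
  have hx' : ‖x‖ ≠ 0 := norm_ne_zero_iff.2 hx
  have hsq : ∑ i, inner ℝ x (b i) ^ 2 = ‖x‖ ^ 2 := b.sum_sq_inner_left x
  have hdir : ∑ i, inner ℝ x (b i) * fderiv ℝ g x (b i) = fderiv ℝ g x x := by
    calc _ = fderiv ℝ g x (∑ i, inner ℝ (b i) x • b i) := by simp [real_inner_comm]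
      _ = _ := by rw [b.sum_repr']
  have hterm (i) : iteratedFDeriv ℝ 2 (fun y => φ ‖y‖ * g y) x ![b i, b i] =
      (deriv (deriv φ) ‖x‖ / ‖x‖ ^ 2 - deriv φ ‖x‖ / ‖x‖ ^ 3) * g x * inner ℝ x (b i) ^ 2 +
        deriv φ ‖x‖ / ‖x‖ * g x +
        2 * (deriv φ ‖x‖ / ‖x‖) * (inner ℝ x (b i) * fderiv ℝ g x (b i)) +
        φ ‖x‖ * iteratedFDeriv ℝ 2 g x ![b i, b i] := by
    rw [iteratedFDeriv_two_mul_apply (hφ.comp_norm hx) hg,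
      iteratedFDeriv_two_comp_norm_apply hx hφ,
      fderiv_comp_norm_apply hx hφ.eventually_differentiableAt.self_of_nhds, b.norm_eq_one]
    ring
  rw [laplacian, Finset.sum_congr rfl fun i _ => hterm i]
  simp only [Finset.sum_add_distrib, ← Finset.mul_sum, hsq, hdir, Finset.sum_const,
    Finset.card_univ, Fintype.card_fin, nsmul_eq_mul]
  rw [laplacian]
  field_simp
  ring

end Calculus

theorem fderiv_apply_self_of_homogeneous {E : Type*} [NormedAddCommGroup E] [NormedSpace ℝ E]
    {g : E → ℝ} {k : ℕ} (hg : ∀ (t : ℝ) x, g (t • x) = t ^ k * g x) {x : E}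
    (hd : DifferentiableAt ℝ g x) : fderiv ℝ g x x = k * g x := by
  have hline : HasDerivAt (fun t : ℝ => t • x) x 1 := by
    simpa using (hasDerivAt_id (1 : ℝ)).smul_const x
  have hcomp : HasDerivAt (fun t : ℝ => g (t • x)) (fderiv ℝ g x x) 1 :=
    HasFDerivAt.comp_hasDerivAt (1 : ℝ) (by simpa using hd.hasFDerivAt) hline
  have hpow : HasDerivAt (fun t : ℝ => g (t • x)) (k * g x) 1 := by
    simp only [hg]
    simpa using (hasDerivAt_pow k (1 : ℝ)).mul_const (g x)
  exact hcomp.unique hpow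

theorem MvPolynomial.IsHomogeneous.eval_smul {σ R : Type*} [CommSemiring R]
    {p : MvPolynomial σ R} {k : ℕ} (hp : p.IsHomogeneous k) (t : R) (x : σ → R) :
    MvPolynomial.eval (t • x) p = t ^ k * MvPolynomial.eval x p := by
  rw [MvPolynomial.eval_eq, MvPolynomial.eval_eq, Finset.mul_sum]
  refine Finset.sum_congr rfl fun d hd => ?_
  have hdeg : ∑ i ∈ d.support, d i = k := by
    simpa [Finsupp.weight_apply, Finsupp.sum] using hp (MvPolynomial.mem_support_iff.1 hd)
  simp only [Pi.smul_apply, smul_eq_mul, mul_pow, Finset.prod_mul_distrib,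
    Finset.prod_pow_eq_pow_sum, hdeg]
  ring

theorem contDiff_eval_mvPolynomial {n : ℕ} (p : MvPolynomial (Fin n) ℝ) :
    ContDiff ℝ 2 fun x : EuclideanSpace ℝ (Fin n) => MvPolynomial.eval x p := by
  simp only [MvPolynomial.eval_eq]
  fun_prop

theorem deriv_div_pow {h : ℝ → ℝ} {r : ℝ} (hr : 0 < r) (hd : DifferentiableAt ℝ h r) (k : ℕ) :
    deriv (fun s => h s / s ^ k) r = deriv h r / r ^ k - k * h r / r ^ (k + 1) := by
  rw [(hd.hasDerivAt.fun_div (hasDerivAt_pow k r) (by positivity)).deriv]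
  rcases k with _ | k
  · simp
  · simp only [Nat.add_sub_cancel]
    field_simp
    ring

theorem deriv_deriv_div_pow {h : ℝ → ℝ} {r : ℝ} (hr : 0 < r) (hh : ContDiffAt ℝ 2 h r) (k : ℕ) :
    deriv (deriv fun s => h s / s ^ k) r =
      deriv (deriv h) r / r ^ k - 2 * k * deriv h r / r ^ (k + 1) +
        k * (k + 1) * h r / r ^ (k + 2) := by
  have heq : deriv (fun s => h s / s ^ k) =ᶠ[nhds r]
      fun s => deriv h s / s ^ k - k * (h s / s ^ (k + 1)) := by
    filter_upwards [hh.eventually_differentiableAt, isOpen_Ioi.mem_nhds hr] with s hs hs0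
    rw [deriv_div_pow hs0 hs, mul_div_assoc]
  have hd := hh.eventually_differentiableAt.self_of_nhds
  have hd' := hh.differentiableAt_deriv
  have hdiv {g : ℝ → ℝ} (hg : DifferentiableAt ℝ g r) (m : ℕ) :
      DifferentiableAt ℝ (fun s => g s / s ^ m) r :=
    hg.fun_div (differentiableAt_pow m) (by positivity)
  rw [heq.deriv_eq, deriv_fun_sub (hdiv hd' k) ((hdiv hd (k + 1)).const_mul _),
    deriv_const_mul _ (hdiv hd (k + 1)), deriv_div_pow hr hd', deriv_div_pow hr hd]
  push_cast
  ring

/-- Let `N ≥ 3`, `k ≥ 1`, let `G : ℝᴺ → ℝᴺ` have components which are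
harmonic homogeneous polynomials of degree `k` with `‖G(x)‖ = ‖x‖ᵏ` (so `G` maps the sphere
to the sphere), and let `h` be `C²` on `(0, ∞)` solving
`-h'' - (N-1) h'/r + k(k+N-2) h/r² = h (1 - h²)`.  Then
`u(x) = G(x/‖x‖) h(‖x‖) = h(‖x‖) ‖x‖⁻ᵏ G(x)` solves the Ginzburg–Landau system
`Δu = u (‖u‖² - 1)` on `ℝᴺ \ {0}` (componentwise), and `‖u(x)‖ = |h(‖x‖)|` for `x ≠ 0`. -/
theorem ginzburgLandau_equivariant_solution (N k : ℕ) (hN : 3 ≤ N) (hk : 1 ≤ k)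
    (G : EuclideanSpace ℝ (Fin N) → EuclideanSpace ℝ (Fin N))
    (P : Fin N → MvPolynomial (Fin N) ℝ)
    (hPhom : ∀ i, (P i).IsHomogeneous k)
    (hGP : ∀ x i, G x i = MvPolynomial.eval x (P i))
    (hGharm : ∀ (i : Fin N) (x : EuclideanSpace ℝ (Fin N)),
      laplacian (fun y => G y i) x = 0)
    (hGnorm : ∀ x, ‖G x‖ = ‖x‖ ^ k)
    (h : ℝ → ℝ) (hC2 : ContDiffOn ℝ 2 h (Set.Ioi 0))
    (hODE : ∀ r : ℝ, 0 < r →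
      -(deriv (deriv h) r) - ((N : ℝ) - 1) * deriv h r / r +
          (k : ℝ) * ((k : ℝ) + (N : ℝ) - 2) * h r / r ^ 2 = h r * (1 - h r ^ 2))
    (u : EuclideanSpace ℝ (Fin N) → EuclideanSpace ℝ (Fin N))
    (hu : ∀ x, x ≠ 0 → u x = (h ‖x‖ / ‖x‖ ^ k) • G x) :
    ∀ x : EuclideanSpace ℝ (Fin N), x ≠ 0 →
      (∀ i : Fin N, laplacian (fun y => u y i) x = u x i * (‖u x‖ ^ 2 - 1)) ∧
        ‖u x‖ = |h ‖x‖| := by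
  intro x hx
  have hr : 0 < ‖x‖ := norm_pos_iff.2 hx
  have hnorm : ‖u x‖ = |h ‖x‖| := by
    rw [hu x hx, norm_smul, hGnorm, Real.norm_eq_abs, abs_div, abs_of_pos (pow_pos hr k),
      div_mul_cancel₀ _ (pow_pos hr k).ne']
  refine ⟨fun i => ?_, hnorm⟩
  have hh : ContDiffAt ℝ 2 h ‖x‖ := hC2.contDiffAt (isOpen_Ioi.mem_nhds hr)
  have hφ : ContDiffAt ℝ 2 (fun s => h s / s ^ k) ‖x‖ :=
    hh.div (contDiffAt_id.pow k) (by simp [hx])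
  have hg : ContDiff ℝ 2 fun y => G y i := by
    simpa only [hGP] using contDiff_eval_mvPolynomial (P i)
  have hEuler : fderiv ℝ (fun y => G y i) x x = k * G x i := by
    refine fderiv_apply_self_of_homogeneous (fun t y => ?_) (hg.differentiable (by norm_num) x)
    simpa [hGP] using (hPhom i).eval_smul t y
  have hloc : (fun y => u y i) =ᶠ[nhds x] fun y => h ‖y‖ / ‖y‖ ^ k * G y i := by
    filter_upwards [isOpen_ne.mem_nhds hx] with y hy
    simp [hu y hy]
  have hode := hODE ‖x‖ hr
  have hODE' : deriv (deriv h) ‖x‖ = -((N : ℝ) - 1) * deriv h ‖x‖ / ‖x‖ +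
      k * (k + N - 2) * h ‖x‖ / ‖x‖ ^ 2 - h ‖x‖ * (1 - h ‖x‖ ^ 2) := by
    linear_combination -hode
  rw [laplacian_congr hloc, laplacian_radial_mul (φ := fun s => h s / s ^ k) hx hφ hg.contDiffAt,
    hGharm, hEuler, deriv_deriv_div_pow hr hh,
    deriv_div_pow hr hh.eventually_differentiableAt.self_of_nhds, finrank_euclideanSpace_fin,
    hnorm, sq_abs, hu x hx, hODE']
  simp only [PiLp.smul_apply, smul_eq_mul]
  field_simp
  ring
end
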